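/- Let Ψ: ℝ⁶ → ℂ be a Schwartz-class function, M, T ≥ 1, C ≥ 1 fixed, and for (a,b) = (a₁,…,a₄,b₁,…,b₄) ∈ ℝ⁸ define ℋ(a,b) = ∫_{ℝ⁴} e((Tu/2)(a₁b₂ + a₂b₁) + (Tv/2)(a₃b₄ + a₄b₃) + (z₁(a₁+a₂)(b₁+b₂) − z₂(a₃+a₄)(b₃+b₄))/(4M²)) · Ψ(Tu·b₁b₂ + Tv·a₃a₄ + (z₁(b₁+b₂)² − z₂(a₃+a₄)²)/(4M²), Tu·a₁a₂ + Tv·b₃b₄ + (z₁(a₁+a₂)² − z₂(b₃+b₄)²)/(4M²), z₁, z₂, u, v) d(u,v,z₁,z₂), where e(x) = e^{2πix}. Then for every A ≥ 0 and all (a,b) ∈ ℝ⁸ with |aᵢ|, |bᵢ| ≤ CM for all i and P ≠ 0, one has |ℋ(a,b)| ≪_{A,Ψ,C} (T²(|Δ| + P/T))^{−1} · ((1 + |Δ₁|/(|Δ| + P/T))·(1 + |Δ₂|/(|Δ| + P/T)))^{−A}. -/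

import Mathlib

open MeasureTheory
open scoped SchwartzMap

noncomputable section

/-- The oscillatory integral `ℋ(a,b)` attached to a Schwartz function `Ψ` on `ℝ⁶`. -/
def Hosc (Ψ : 𝓢(ℝ × ℝ × ℝ × ℝ × ℝ × ℝ, ℂ)) (M T : ℝ)
    (a₁ a₂ a₃ a₄ b₁ b₂ b₃ b₄ : ℝ) : ℂ :=
  ∫ u : ℝ, ∫ v : ℝ, ∫ z₁ : ℝ, ∫ z₂ : ℝ,
    Complex.exp (2 * Real.pi * Complex.I *
      (T * u / 2 * (a₁ * b₂ + a₂ * b₁) + T * v / 2 * (a₃ * b₄ + a₄ * b₃) +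
        (z₁ * ((a₁ + a₂) * (b₁ + b₂)) - z₂ * ((a₃ + a₄) * (b₃ + b₄))) / (4 * M ^ 2))) *
    Ψ (T * u * (b₁ * b₂) + T * v * (a₃ * a₄) +
         (z₁ * (b₁ + b₂) ^ 2 - z₂ * (a₃ + a₄) ^ 2) / (4 * M ^ 2),
       T * u * (a₁ * a₂) + T * v * (b₃ * b₄) +
         (z₁ * (a₁ + a₂) ^ 2 - z₂ * (b₃ + b₄) ^ 2) / (4 * M ^ 2),
       z₁, z₂, u, v)

/-- `P = max(|a₁a₂|, |a₃a₄|, |b₁b₂|, |b₃b₄|)`. -/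
def Pmax (a₁ a₂ a₃ a₄ b₁ b₂ b₃ b₄ : ℝ) : ℝ :=
  max (max |a₁ * a₂| |a₃ * a₄|) (max |b₁ * b₂| |b₃ * b₄|)

/-- `Δ = a₁a₂a₃a₄ - b₁b₂b₃b₄`. -/
def Δ₀ (a₁ a₂ a₃ a₄ b₁ b₂ b₃ b₄ : ℝ) : ℝ := a₁ * a₂ * a₃ * a₄ - b₁ * b₂ * b₃ * b₄

/-- `Δ₁ = a₁a₂b₃a₄ + a₁a₂a₃b₄ - a₁b₂b₃b₄ - b₁a₂b₃b₄`. -/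
def Δ₁ (a₁ a₂ a₃ a₄ b₁ b₂ b₃ b₄ : ℝ) : ℝ :=
  a₁ * a₂ * b₃ * a₄ + a₁ * a₂ * a₃ * b₄ - a₁ * b₂ * b₃ * b₄ - b₁ * a₂ * b₃ * b₄

/-- `Δ₂ = a₁b₂a₃a₄ + b₁a₂a₃a₄ - b₁b₂a₃b₄ - b₁b₂b₃a₄`. -/
def Δ₂ (a₁ a₂ a₃ a₄ b₁ b₂ b₃ b₄ : ℝ) : ℝ :=
  a₁ * b₂ * a₃ * a₄ + b₁ * a₂ * a₃ * a₄ - b₁ * b₂ * a₃ * b₄ - b₁ * b₂ * b₃ * a₄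

end

open LineDeriv in
theorem integral_exp_mul_lineDerivOp_comp {E F : Type*} [NormedAddCommGroup E] [NormedSpace ℝ E]
    [FiniteDimensional ℝ E] [MeasurableSpace E] [BorelSpace E] (μ : Measure E)
    [μ.IsAddHaarMeasure] [NormedAddCommGroup F] [NormedSpace ℝ F]
    (ℓ : E →L[ℝ] ℝ) (L : E →L[ℝ] F) {K : NNReal} (hL : AntilipschitzWith K L)
    (Φ : 𝓢(F, ℂ)) (w : E) :
    ∫ x, Complex.exp (2 * Real.pi * Complex.I * ℓ x) * (∂_{L w} Φ) (L x) ∂μ =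
      -(2 * Real.pi * Complex.I * ℓ w) *
        ∫ x, Complex.exp (2 * Real.pi * Complex.I * ℓ x) * Φ (L x) ∂μ := by
  have hint (Θ : 𝓢(F, ℂ)) : Integrable (fun x ↦ Θ (L x)) μ :=
    (SchwartzMap.compCLMOfAntilipschitz ℝ L.hasTemperateGrowth hL Θ).integrable
  have hexp (Θ : 𝓢(F, ℂ)) :
      Integrable (fun x ↦ Complex.exp (2 * Real.pi * Complex.I * ℓ x) * Θ (L x)) μ := by
    refine (hint Θ).bdd_mul (c := 1) (by fun_prop) (.of_forall fun x ↦ ?_)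
    simp [Complex.norm_exp]
  have hE (x : E) : HasLineDerivAt ℝ (fun x ↦ Complex.exp (2 * Real.pi * Complex.I * ℓ x))
      (2 * Real.pi * Complex.I * ℓ w * Complex.exp (2 * Real.pi * Complex.I * ℓ x)) x w := by
    have h1 : HasFDerivAt (fun x ↦ (2 * Real.pi * Complex.I * ℓ x : ℂ))
        ((2 * Real.pi * Complex.I : ℂ) • Complex.ofRealCLM.comp ℓ) x :=
      (Complex.ofRealCLM.comp ℓ).hasFDerivAt.const_mul _
    convert! h1.cexp.hasLineDerivAt w using 1
    simp
    ring
  have hΦ (x : E) : HasLineDerivAt ℝ (fun x ↦ Φ (L x)) ((∂_{L w} Φ) (L x)) x w := by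
    rw [SchwartzMap.lineDerivOp_apply_eq_fderiv]
    exact ((Φ.differentiableAt (x := L x)).hasFDerivAt.comp x L.hasFDerivAt).hasLineDerivAt w
  have key := integral_bilinear_hasLineDerivAt_right_eq_neg_left_of_integrable
    (B := ContinuousLinearMap.mul ℝ ℂ) (μ := μ) (v := w)
    (by simpa [mul_assoc] using (hexp Φ).const_mul (2 * Real.pi * Complex.I * ℓ w))
    (by simpa using hexp (∂_{L w} Φ)) (by simpa using hexp Φ)
    (fun x _ ↦ hE x) (fun x _ ↦ hΦ x)
  simp only [ContinuousLinearMap.mul_apply'] at key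
  rw [key, ← integral_const_mul, ← integral_neg]
  congr 1 with x
  ring

open LineDeriv in
theorem integral_exp_mul_iteratedLineDerivOp_comp {E F : Type*} [NormedAddCommGroup E]
    [NormedSpace ℝ E] [FiniteDimensional ℝ E] [MeasurableSpace E] [BorelSpace E] (μ : Measure E)
    [μ.IsAddHaarMeasure] [NormedAddCommGroup F] [NormedSpace ℝ F]
    (ℓ : E →L[ℝ] ℝ) (L : E →L[ℝ] F) {K : NNReal} (hL : AntilipschitzWith K L)
    (Φ : 𝓢(F, ℂ)) {n : ℕ} (w : Fin n → E) :
    ∫ x, Complex.exp (2 * Real.pi * Complex.I * ℓ x) * (∂^{fun i ↦ L (w i)} Φ) (L x) ∂μ =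
      (∏ i, -(2 * Real.pi * Complex.I * ℓ (w i))) *
        ∫ x, Complex.exp (2 * Real.pi * Complex.I * ℓ x) * Φ (L x) ∂μ := by
  induction n with
  | zero => simp
  | succ n ih =>
    rw [iteratedLineDerivOp_succ_left, integral_exp_mul_lineDerivOp_comp μ ℓ L hL]
    simp only [Fin.tail_def]
    rw [ih (fun i ↦ w i.succ), Fin.prod_univ_succ]
    ring

/-- The product weight `∏ᵢ (1 + yᵢ²)⁻¹` on `ℝ⁶`. -/
noncomputable def prodWeight (y : ℝ × ℝ × ℝ × ℝ × ℝ × ℝ) : ℝ :=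
  (1 + y.1 ^ 2)⁻¹ * (1 + y.2.1 ^ 2)⁻¹ * (1 + y.2.2.1 ^ 2)⁻¹ * (1 + y.2.2.2.1 ^ 2)⁻¹ *
    (1 + y.2.2.2.2.1 ^ 2)⁻¹ * (1 + y.2.2.2.2.2 ^ 2)⁻¹

theorem inv_one_add_norm_pow_le_prodWeight (y : ℝ × ℝ × ℝ × ℝ × ℝ × ℝ) :
    ((1 + ‖y‖) ^ 12)⁻¹ ≤ prodWeight y := by
  have h (t : ℝ) (ht : |t| ≤ ‖y‖) : 1 + t ^ 2 ≤ (1 + ‖y‖) ^ 2 := by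
    rw [← sq_abs]
    nlinarith [abs_nonneg t]
  have e1 : |y.1| ≤ ‖y‖ := norm_fst_le y
  have g1 : ‖y.2‖ ≤ ‖y‖ := norm_snd_le y
  have e2 : |y.2.1| ≤ ‖y‖ := (norm_fst_le y.2).trans g1
  have g2 : ‖y.2.2‖ ≤ ‖y‖ := (norm_snd_le y.2).trans g1
  have e3 : |y.2.2.1| ≤ ‖y‖ := (norm_fst_le y.2.2).trans g2
  have g3 : ‖y.2.2.2‖ ≤ ‖y‖ := (norm_snd_le y.2.2).trans g2
  have e4 : |y.2.2.2.1| ≤ ‖y‖ := (norm_fst_le y.2.2.2).trans g3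
  have g4 : ‖y.2.2.2.2‖ ≤ ‖y‖ := (norm_snd_le y.2.2.2).trans g3
  have e5 : |y.2.2.2.2.1| ≤ ‖y‖ := (norm_fst_le y.2.2.2.2).trans g4
  have e6 : |y.2.2.2.2.2| ≤ ‖y‖ := (norm_snd_le y.2.2.2.2).trans g4
  simp only [prodWeight, ← mul_inv]
  refine inv_anti₀ (by positivity) ?_
  calc _ ≤ (1 + ‖y‖) ^ 2 * (1 + ‖y‖) ^ 2 * (1 + ‖y‖) ^ 2 * (1 + ‖y‖) ^ 2 * (1 + ‖y‖) ^ 2 *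
        (1 + ‖y‖) ^ 2 := by
        gcongr <;> exact h _ ‹_›
    _ = _ := by ring

open LineDeriv in
theorem exists_norm_iteratedLineDerivOp_le (Ψ : 𝓢(ℝ × ℝ × ℝ × ℝ × ℝ × ℝ, ℂ)) (n : ℕ) :
    ∃ C : ℝ, 0 < C ∧ ∀ (m : Fin n → ℝ × ℝ × ℝ × ℝ × ℝ × ℝ) y,
      ‖(∂^{m} Ψ) y‖ ≤ C * (∏ i, ‖m i‖) * prodWeight y := by
  set S := 2 ^ 12 * ((Finset.Iic (12, n)).sup fun m ↦ SchwartzMap.seminorm ℝ m.1 m.2) Ψ with hS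
  have hS0 : 0 ≤ S := by positivity
  refine ⟨S + 1, by positivity, fun m y ↦ ?_⟩
  have h := SchwartzMap.one_add_le_sup_seminorm_apply (𝕜 := ℝ) (m := (12, n)) le_rfl le_rfl Ψ y
  have h' : ‖iteratedFDeriv ℝ n Ψ y‖ ≤ (S + 1) * ((1 + ‖y‖) ^ 12)⁻¹ := by
    rw [← div_eq_mul_inv, le_div_iff₀ (by positivity), mul_comm]
    exact h.trans (by simp only [hS]; linarith)
  rw [SchwartzMap.iteratedLineDerivOp_eq_iteratedFDeriv]
  calc _ ≤ ‖iteratedFDeriv ℝ n Ψ y‖ * ∏ i, ‖m i‖ := ContinuousMultilinearMap.le_opNorm _ _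
    _ ≤ ((S + 1) * prodWeight y) * ∏ i, ‖m i‖ := by
        gcongr
        exact h'.trans (by gcongr; exact inv_one_add_norm_pow_le_prodWeight y)
    _ = _ := by ring

theorem lintegral_inv_one_add_sq :
    ∫⁻ t : ℝ, ENNReal.ofReal (1 + t ^ 2)⁻¹ = ENNReal.ofReal Real.pi := by
  rw [← ofReal_integral_eq_lintegral_ofReal integrable_inv_one_add_sq
    (.of_forall fun t ↦ by positivity), integral_univ_inv_one_add_sq]

theorem lintegral_inv_one_add_sq_mul_inv_one_add_sq :
    ∫⁻ x : ℝ × ℝ, ENNReal.ofReal ((1 + x.1 ^ 2)⁻¹ * (1 + x.2 ^ 2)⁻¹) =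
      ENNReal.ofReal (Real.pi ^ 2) := by
  have h (x : ℝ × ℝ) : ENNReal.ofReal ((1 + x.1 ^ 2)⁻¹ * (1 + x.2 ^ 2)⁻¹) =
      ENNReal.ofReal (1 + x.1 ^ 2)⁻¹ * ENNReal.ofReal (1 + x.2 ^ 2)⁻¹ :=
    ENNReal.ofReal_mul (by positivity)
  simp_rw [h]
  rw [Measure.volume_eq_prod, lintegral_prod_mul (f := fun t ↦ ENNReal.ofReal (1 + t ^ 2)⁻¹)
    (g := fun t ↦ ENNReal.ofReal (1 + t ^ 2)⁻¹) (by fun_prop) (by fun_prop),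
    lintegral_inv_one_add_sq, ← ENNReal.ofReal_mul Real.pi_pos.le, sq]

theorem lintegral_comp_affine_two {p q r s : ℝ} (hd : p * s - q * r ≠ 0) (c c' : ℝ) :
    ∫⁻ x : ℝ × ℝ, ENNReal.ofReal
        ((1 + (p * x.1 + q * x.2 + c) ^ 2)⁻¹ * (1 + (r * x.1 + s * x.2 + c') ^ 2)⁻¹) =
      ENNReal.ofReal (Real.pi ^ 2 / |p * s - q * r|) := by
  set f : ℝ × ℝ →ₗ[ℝ] ℝ × ℝ :=
    Matrix.toLin (Module.Basis.finTwoProd ℝ) (Module.Basis.finTwoProd ℝ) !![p, q; r, s] with hf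
  have hdet : LinearMap.det f = p * s - q * r := by
    rw [hf, LinearMap.det_toLin, Matrix.det_fin_two_of]
  have hfx (x : ℝ × ℝ) : f x = (p * x.1 + q * x.2, r * x.1 + s * x.2) :=
    Matrix.toLin_finTwoProd_apply p q r s x
  have hcont : Continuous f := f.continuous_of_finiteDimensional
  set g : ℝ × ℝ → ENNReal := fun x ↦ ENNReal.ofReal ((1 + x.1 ^ 2)⁻¹ * (1 + x.2 ^ 2)⁻¹) with hg
  have hgm : Measurable g := by fun_prop
  calc _ = ∫⁻ x, g (f x + (c, c')) := by simp [hg, hfx]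
    _ = ∫⁻ y, g (y + (c, c')) ∂(Measure.map f volume) :=
        (lintegral_map (hgm.comp (measurable_add_const _)) hcont.measurable).symm
    _ = ENNReal.ofReal |(p * s - q * r)⁻¹| * ∫⁻ y, g (y + (c, c')) := by
        rw [Measure.map_linearMap_addHaar_eq_smul_addHaar volume (by rwa [hdet]),
          lintegral_smul_measure, hdet, smul_eq_mul]
    _ = _ := by
        rw [lintegral_add_right_eq_self, hg, lintegral_inv_one_add_sq_mul_inv_one_add_sq,
          ← ENNReal.ofReal_mul (by positivity), abs_inv, mul_comm, div_eq_mul_inv]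

theorem lintegral_comp_affine_four {p q r s : ℝ} (hd : p * s - q * r ≠ 0) {c c' : ℝ × ℝ → ℝ}
    (hc : Measurable c) (hc' : Measurable c') :
    ∫⁻ x : (ℝ × ℝ) × (ℝ × ℝ), ENNReal.ofReal
        (((1 + x.2.1 ^ 2)⁻¹ * (1 + x.2.2 ^ 2)⁻¹) *
          ((1 + (p * x.1.1 + q * x.1.2 + c x.2) ^ 2)⁻¹ *
            (1 + (r * x.1.1 + s * x.1.2 + c' x.2) ^ 2)⁻¹)) =
      ENNReal.ofReal (Real.pi ^ 4 / |p * s - q * r|) := by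
  rw [Measure.volume_eq_prod (ℝ × ℝ) (ℝ × ℝ), lintegral_prod_symm _ (by fun_prop)]
  have h (z x : ℝ × ℝ) : ENNReal.ofReal (((1 + z.1 ^ 2)⁻¹ * (1 + z.2 ^ 2)⁻¹) *
          ((1 + (p * x.1 + q * x.2 + c z) ^ 2)⁻¹ * (1 + (r * x.1 + s * x.2 + c' z) ^ 2)⁻¹)) =
      ENNReal.ofReal ((1 + z.1 ^ 2)⁻¹ * (1 + z.2 ^ 2)⁻¹) * ENNReal.ofReal
        ((1 + (p * x.1 + q * x.2 + c z) ^ 2)⁻¹ * (1 + (r * x.1 + s * x.2 + c' z) ^ 2)⁻¹) :=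
    ENNReal.ofReal_mul (by positivity)
  simp_rw [h]
  have h2 (z : ℝ × ℝ) := lintegral_const_mul
    (ENNReal.ofReal ((1 + z.1 ^ 2)⁻¹ * (1 + z.2 ^ 2)⁻¹)) (μ := (volume : Measure (ℝ × ℝ)))
    (f := fun x : ℝ × ℝ ↦ ENNReal.ofReal
      ((1 + (p * x.1 + q * x.2 + c z) ^ 2)⁻¹ * (1 + (r * x.1 + s * x.2 + c' z) ^ 2)⁻¹))
    (by fun_prop)
  simp_rw [h2, lintegral_comp_affine_two hd]
  rw [lintegral_mul_const _ (by fun_prop), lintegral_inv_one_add_sq_mul_inv_one_add_sq,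
    ← ENNReal.ofReal_mul (by positivity)]
  congr 1
  ring

/-- The linear map `(u, v, z₁, z₂) ↦ (pu + qv + αz₁ + α'z₂, ru + sv + βz₁ + β'z₂, z₁, z₂, u, v)`. -/
noncomputable def oscMap (p q r s α α' β β' : ℝ) :
    (ℝ × ℝ) × (ℝ × ℝ) →L[ℝ] ℝ × ℝ × ℝ × ℝ × ℝ × ℝ :=
  LinearMap.toContinuousLinearMap
    { toFun := fun x ↦ (p * x.1.1 + q * x.1.2 + (α * x.2.1 + α' * x.2.2),
        r * x.1.1 + s * x.1.2 + (β * x.2.1 + β' * x.2.2), x.2.1, x.2.2, x.1.1, x.1.2)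
      map_add' := fun x y ↦ by ext <;> simp <;> ring
      map_smul' := fun c x ↦ by ext <;> simp <;> ring }

theorem oscMap_apply (p q r s α α' β β' : ℝ) (x : (ℝ × ℝ) × (ℝ × ℝ)) :
    oscMap p q r s α α' β β' x = (p * x.1.1 + q * x.1.2 + (α * x.2.1 + α' * x.2.2),
      r * x.1.1 + s * x.1.2 + (β * x.2.1 + β' * x.2.2), x.2.1, x.2.2, x.1.1, x.1.2) :=
  rfl

theorem antilipschitzWith_oscMap (p q r s α α' β β' : ℝ) :
    AntilipschitzWith 1 (oscMap p q r s α α' β β') := by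
  refine AddMonoidHomClass.antilipschitz_of_bound _ fun x ↦ ?_
  simp only [oscMap_apply, Prod.norm_def, NNReal.coe_one, one_mul]
  refine max_le (max_le ?_ ?_) (max_le ?_ ?_) <;> simp

/-- The largest absolute value of a coefficient of a `2 × 2` matrix. -/
def maxCoeff (p q r s : ℝ) : ℝ := max (max |r| |q|) (max |p| |s|)

theorem inv_one_add_sq_le_one (t : ℝ) : (1 + t ^ 2)⁻¹ ≤ 1 :=
  inv_le_one_of_one_le₀ (by nlinarith [sq_nonneg t])

theorem lintegral_prodWeight_oscMap_le {p q r s : ℝ} (α α' β β' : ℝ)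
    (hN : 0 < maxCoeff p q r s) :
    ∫⁻ x, ENNReal.ofReal (prodWeight (oscMap p q r s α α' β β' x)) ≤
      ENNReal.ofReal (2 * Real.pi ^ 4 / (|p * s - q * r| + maxCoeff p q r s)) := by
  set X : (ℝ × ℝ) × (ℝ × ℝ) → ℝ := fun x ↦ p * x.1.1 + q * x.1.2 + (α * x.2.1 + α' * x.2.2)
  set Y : (ℝ × ℝ) × (ℝ × ℝ) → ℝ := fun x ↦ r * x.1.1 + s * x.1.2 + (β * x.2.1 + β' * x.2.2)
  have key (p' q' r' s' : ℝ) (c c' : ℝ × ℝ → ℝ) (hc : Measurable c) (hc' : Measurable c')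
      (hd : |p * s - q * r| + maxCoeff p q r s ≤ 2 * |p' * s' - q' * r'|)
      (hle : ∀ x : (ℝ × ℝ) × (ℝ × ℝ), (1 + X x ^ 2)⁻¹ * (1 + Y x ^ 2)⁻¹ *
          ((1 + x.1.1 ^ 2)⁻¹ * (1 + x.1.2 ^ 2)⁻¹) ≤
        (1 + (p' * x.1.1 + q' * x.1.2 + c x.2) ^ 2)⁻¹ *
            (1 + (r' * x.1.1 + s' * x.1.2 + c' x.2) ^ 2)⁻¹) :
      ∫⁻ x, ENNReal.ofReal (prodWeight (oscMap p q r s α α' β β' x)) ≤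
        ENNReal.ofReal (2 * Real.pi ^ 4 / (|p * s - q * r| + maxCoeff p q r s)) := by
    have hd0 : 0 < |p' * s' - q' * r'| := by linarith [abs_nonneg (p * s - q * r)]
    calc _ ≤ ∫⁻ x : (ℝ × ℝ) × (ℝ × ℝ), ENNReal.ofReal
          (((1 + x.2.1 ^ 2)⁻¹ * (1 + x.2.2 ^ 2)⁻¹) *
            ((1 + (p' * x.1.1 + q' * x.1.2 + c x.2) ^ 2)⁻¹ *
              (1 + (r' * x.1.1 + s' * x.1.2 + c' x.2) ^ 2)⁻¹)) := by
          refine lintegral_mono fun x ↦ ENNReal.ofReal_le_ofReal ?_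
          refine le_trans (le_of_eq ?_) (mul_le_mul_of_nonneg_left (hle x) (by positivity))
          simp only [prodWeight, oscMap_apply, X, Y]
          ring
      _ = ENNReal.ofReal (Real.pi ^ 4 / |p' * s' - q' * r'|) :=
          lintegral_comp_affine_four (abs_pos.1 hd0) hc hc'
      _ ≤ _ := by
          refine ENNReal.ofReal_le_ofReal ?_
          rw [div_le_div_iff₀ hd0 (by positivity)]
          nlinarith [pow_pos Real.pi_pos 4]
  have hb (t : ℝ) : 0 ≤ (1 + t ^ 2)⁻¹ := by positivity
  have drop {a b c d : ℝ} (ha : 0 ≤ a) (hb : 0 ≤ b) (hc : 0 ≤ c) (hd : 0 ≤ d) (hc1 : c ≤ 1)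
      (hd1 : d ≤ 1) : a * b * (c * d) ≤ a * b :=
    mul_le_of_le_one_right (by positivity) (mul_le_one₀ hc1 hd hd1)
  have e1 := inv_one_add_sq_le_one
  rcases le_total (maxCoeff p q r s) |p * s - q * r| with hDN | hDN
  · refine key p q r s (fun z ↦ α * z.1 + α' * z.2) (fun z ↦ β * z.1 + β' * z.2) (by fun_prop)
      (by fun_prop) (by linarith) fun x ↦ ?_
    exact drop (hb _) (hb _) (hb _) (hb _) (e1 _) (e1 _)
  have hmax : maxCoeff p q r s = |r| ∨ maxCoeff p q r s = |q| ∨ maxCoeff p q r s = |p| ∨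
      maxCoeff p q r s = |s| := by
    unfold maxCoeff
    rcases max_choice (max |r| |q|) (max |p| |s|) with h | h <;> rw [h]
    · rcases max_choice |r| |q| with h | h <;> simp [h]
    · rcases max_choice |p| |s| with h | h <;> simp [h]
  rcases hmax with h | h | h | h
  · refine key r s 0 1 (fun z ↦ β * z.1 + β' * z.2) (fun _ ↦ 0) (by fun_prop)
      (by fun_prop) (by simp; linarith) fun x ↦ ?_
    refine le_trans (le_of_eq ?_) (drop (hb (Y x)) (hb x.1.2) (hb (X x)) (hb x.1.1) (e1 _) (e1 _))
      |>.trans (le_of_eq ?_)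
    · ring
    · simp [Y]
  · refine key p q 1 0 (fun z ↦ α * z.1 + α' * z.2) (fun _ ↦ 0) (by fun_prop)
      (by fun_prop) (by simp; linarith) fun x ↦ ?_
    refine le_trans (le_of_eq ?_) (drop (hb (X x)) (hb x.1.1) (hb (Y x)) (hb x.1.2) (e1 _) (e1 _))
      |>.trans (le_of_eq ?_)
    · ring
    · simp [X]
  · refine key p q 0 1 (fun z ↦ α * z.1 + α' * z.2) (fun _ ↦ 0) (by fun_prop)
      (by fun_prop) (by simp; linarith) fun x ↦ ?_
    refine le_trans (le_of_eq ?_) (drop (hb (X x)) (hb x.1.2) (hb (Y x)) (hb x.1.1) (e1 _) (e1 _))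
      |>.trans (le_of_eq ?_)
    · ring
    · simp [X]
  · refine key r s 1 0 (fun z ↦ β * z.1 + β' * z.2) (fun _ ↦ 0) (by fun_prop)
      (by fun_prop) (by simp; linarith) fun x ↦ ?_
    refine le_trans (le_of_eq ?_) (drop (hb (Y x)) (hb x.1.1) (hb (X x)) (hb x.1.2) (e1 _) (e1 _))
      |>.trans (le_of_eq ?_)
    · ring
    · simp [Y]

theorem norm_oscMap_le {p q r s : ℝ} (α α' β β' : ℝ) {x y : ℝ}
    (hx : |x| ≤ |p * s - q * r| + maxCoeff p q r s) (hy : |y| ≤ |p * s - q * r| + maxCoeff p q r s)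
    (hX : |p * x + q * y| ≤ |p * s - q * r|) (hY : |r * x + s * y| ≤ |p * s - q * r|)
    (hN : 0 < maxCoeff p q r s) :
    ‖oscMap p q r s α α' β β' ((x, y), 0)‖ ≤ |p * s - q * r| + maxCoeff p q r s := by
  have h0 := abs_nonneg (p * s - q * r)
  simp only [oscMap_apply, Prod.norm_def, Prod.fst_zero, Prod.snd_zero, mul_zero, add_zero,
    Real.norm_eq_abs, abs_zero]
  refine max_le ?_ (max_le ?_ (max_le ?_ (max_le ?_ (max_le hx hy)))) <;> linarith

open LineDeriv in
theorem exists_norm_integral_mul_pow_le (Ψ : 𝓢(ℝ × ℝ × ℝ × ℝ × ℝ × ℝ, ℂ)) (j k : ℕ) :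
    ∃ C : ℝ, 0 < C ∧ ∀ (p q r s α α' β β' : ℝ) (ℓ : (ℝ × ℝ) × (ℝ × ℝ) →L[ℝ] ℝ),
      0 < maxCoeff p q r s →
      ‖∫ x, Complex.exp (2 * Real.pi * Complex.I * ℓ x) * Ψ (oscMap p q r s α α' β β' x)‖ *
          (|2 * Real.pi * ℓ ((q, -p), 0)| ^ j * |2 * Real.pi * ℓ ((s, -r), 0)| ^ k) ≤
        C * (|p * s - q * r| + maxCoeff p q r s) ^ (j + k) *
          (|p * s - q * r| + maxCoeff p q r s)⁻¹ := by
  obtain ⟨C, hC, hb⟩ := exists_norm_iteratedLineDerivOp_le Ψ (j + k)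
  refine ⟨C * (2 * Real.pi ^ 4), by positivity, fun p q r s α α' β β' ℓ hN ↦ ?_⟩
  set L := oscMap p q r s α α' β β' with hLdef
  set S := |p * s - q * r| + maxCoeff p q r s with hS
  have hS0 : 0 < S := by positivity
  have hr : |r| ≤ maxCoeff p q r s := (le_max_left _ _).trans (le_max_left _ _)
  have hq : |q| ≤ maxCoeff p q r s := (le_max_right _ _).trans (le_max_left _ _)
  have hp : |p| ≤ maxCoeff p q r s := (le_max_left _ _).trans (le_max_right _ _)
  have hs : |s| ≤ maxCoeff p q r s := (le_max_right _ _).trans (le_max_right _ _)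
  have h0 := abs_nonneg (p * s - q * r)
  have hw₁ : ‖L ((q, -p), 0)‖ ≤ S := by
    refine norm_oscMap_le α α' β β' (by linarith) (by rw [abs_neg]; linarith) ?_ ?_ hN
    · rw [show p * q + q * -p = 0 by ring, abs_zero]; exact h0
    · rw [show r * q + s * -p = -(p * s - q * r) by ring, abs_neg]
  have hw₂ : ‖L ((s, -r), 0)‖ ≤ S := by
    refine norm_oscMap_le α α' β β' (by linarith) (by rw [abs_neg]; linarith) ?_ ?_ hN
    · rw [show p * s + q * -r = p * s - q * r by ring]
    · rw [show r * s + s * -r = 0 by ring, abs_zero]; exact h0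
  set w : Fin (j + k) → (ℝ × ℝ) × (ℝ × ℝ) :=
    Fin.append (fun _ ↦ ((q, -p), 0)) (fun _ ↦ ((s, -r), 0)) with hw
  have hprod : ∏ i, ‖L (w i)‖ ≤ S ^ (j + k) := by
    refine (Finset.prod_le_prod (fun i _ ↦ norm_nonneg _) (g := fun _ ↦ S) fun i _ ↦ ?_).trans_eq
      (by simp)
    refine Fin.addCases (fun i ↦ ?_) (fun i ↦ ?_) i
    · simpa [hw] using hw₁
    · simpa [hw] using hw₂
  have hcoef : ‖∏ i, -(2 * Real.pi * Complex.I * ℓ (w i) : ℂ)‖ =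
      |2 * Real.pi * ℓ ((q, -p), 0)| ^ j * |2 * Real.pi * ℓ ((s, -r), 0)| ^ k := by
    rw [Fin.prod_univ_add]
    simp [hw, abs_mul]
  have : (volume : Measure ((ℝ × ℝ) × (ℝ × ℝ))).IsAddHaarMeasure := by
    rw [Measure.volume_eq_prod]
    infer_instance
  have key := integral_exp_mul_iteratedLineDerivOp_comp volume ℓ L
    (antilipschitzWith_oscMap p q r s α α' β β') Ψ w
  rw [mul_comm, ← hcoef, ← norm_mul, ← key]
  refine (norm_integral_le_lintegral_norm _).trans (ENNReal.toReal_le_of_le_ofReal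
    (by positivity) ?_)
  calc _ ≤ ∫⁻ x, ENNReal.ofReal (C * S ^ (j + k)) * ENNReal.ofReal (prodWeight (L x)) := by
        refine lintegral_mono fun x ↦ ?_
        rw [← ENNReal.ofReal_mul (by positivity)]
        refine ENNReal.ofReal_le_ofReal ?_
        have h1 : ‖Complex.exp (2 * Real.pi * Complex.I * ℓ x)‖ = 1 := by simp [Complex.norm_exp]
        rw [norm_mul, h1, one_mul]
        refine (hb _ _).trans ?_
        have : 0 ≤ prodWeight (L x) := by unfold prodWeight; positivity
        gcongr
    _ = ENNReal.ofReal (C * S ^ (j + k)) * ∫⁻ x, ENNReal.ofReal (prodWeight (L x)) :=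
        lintegral_const_mul' _ _ ENNReal.ofReal_ne_top
    _ ≤ ENNReal.ofReal (C * S ^ (j + k)) * ENNReal.ofReal (2 * Real.pi ^ 4 / S) := by
        gcongr
        exact lintegral_prodWeight_oscMap_le α α' β β' hN
    _ = _ := by
        rw [← ENNReal.ofReal_mul (by positivity)]
        congr 1
        ring

theorem integral_prod_prod_eq_of_norm_le {F : (ℝ × ℝ) × (ℝ × ℝ) → ℂ} (hF : Continuous F) {C : ℝ}
    (hC : ∀ x, ‖F x‖ ≤ C * ((1 + x.1.1 ^ 2)⁻¹ * (1 + x.1.2 ^ 2)⁻¹) *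
      ((1 + x.2.1 ^ 2)⁻¹ * (1 + x.2.2 ^ 2)⁻¹)) :
    ∫ x, F x = ∫ u, ∫ v, ∫ z₁, ∫ z₂, F ((u, v), (z₁, z₂)) := by
  have h2 : Integrable fun z : ℝ × ℝ ↦ (1 + z.1 ^ 2)⁻¹ * (1 + z.2 ^ 2)⁻¹ :=
    integrable_inv_one_add_sq.mul_prod integrable_inv_one_add_sq
  have h4 : Integrable F :=
    ((h2.const_mul C).mul_prod h2).mono' hF.aestronglyMeasurable (.of_forall hC)
  have hsec (w : ℝ × ℝ) : Integrable fun z ↦ F (w, z) :=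
    (h2.const_mul (C * ((1 + w.1 ^ 2)⁻¹ * (1 + w.2 ^ 2)⁻¹))).mono'
      (by fun_prop) (.of_forall fun z ↦ hC (w, z))
  calc ∫ x, F x = ∫ w, ∫ z, F (w, z) := integral_prod _ h4
    _ = ∫ u, ∫ v, ∫ z, F ((u, v), z) := integral_prod _ h4.integral_prod_left
    _ = _ := by
        congr! with u v
        exact integral_prod _ (hsec (u, v))

/-- The linear form `(u, v, z₁, z₂) ↦ eu + fv + gz₁ + hz₂`. -/
noncomputable def oscPhase (e f g h : ℝ) : (ℝ × ℝ) × (ℝ × ℝ) →L[ℝ] ℝ :=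
  LinearMap.toContinuousLinearMap
    { toFun := fun x ↦ e * x.1.1 + f * x.1.2 + g * x.2.1 + h * x.2.2
      map_add' := fun x y ↦ by simp; ring
      map_smul' := fun c x ↦ by simp; ring }

theorem oscPhase_apply (e f g h : ℝ) (x : (ℝ × ℝ) × (ℝ × ℝ)) :
    oscPhase e f g h x = e * x.1.1 + f * x.1.2 + g * x.2.1 + h * x.2.2 :=
  rfl

theorem Hosc_eq_integral (Ψ : 𝓢(ℝ × ℝ × ℝ × ℝ × ℝ × ℝ, ℂ)) (M T a₁ a₂ a₃ a₄ b₁ b₂ b₃ b₄ : ℝ) :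
    Hosc Ψ M T a₁ a₂ a₃ a₄ b₁ b₂ b₃ b₄ =
      ∫ x, Complex.exp (2 * Real.pi * Complex.I *
          oscPhase (T / 2 * (a₁ * b₂ + a₂ * b₁)) (T / 2 * (a₃ * b₄ + a₄ * b₃))
            ((a₁ + a₂) * (b₁ + b₂) / (4 * M ^ 2)) (-((a₃ + a₄) * (b₃ + b₄) / (4 * M ^ 2))) x) *
        Ψ (oscMap (T * (b₁ * b₂)) (T * (a₃ * a₄)) (T * (a₁ * a₂)) (T * (b₃ * b₄))
          ((b₁ + b₂) ^ 2 / (4 * M ^ 2)) (-((a₃ + a₄) ^ 2 / (4 * M ^ 2)))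
          ((a₁ + a₂) ^ 2 / (4 * M ^ 2)) (-((b₃ + b₄) ^ 2 / (4 * M ^ 2))) x) := by
  obtain ⟨C, hC, hb⟩ := exists_norm_iteratedLineDerivOp_le Ψ 0
  rw [integral_prod_prod_eq_of_norm_le (C := C) (by fun_prop)]
  · unfold Hosc
    congr! 11 with u v z₁ z₂
    · simp only [oscPhase_apply]
      push_cast
      ring
    · simp only [oscMap_apply]
      ring
    · simp only [oscMap_apply, Prod.mk.injEq, and_true]
      ring
  · intro x
    have h := hb Fin.elim0 (oscMap (T * (b₁ * b₂)) (T * (a₃ * a₄)) (T * (a₁ * a₂)) (T * (b₃ * b₄))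
          ((b₁ + b₂) ^ 2 / (4 * M ^ 2)) (-((a₃ + a₄) ^ 2 / (4 * M ^ 2)))
          ((a₁ + a₂) ^ 2 / (4 * M ^ 2)) (-((b₃ + b₄) ^ 2 / (4 * M ^ 2))) x)
    simp only [LineDeriv.iteratedLineDerivOp_fin_zero, Finset.univ_eq_empty, Finset.prod_empty,
      mul_one] at h
    have h1 (t : ℝ) : ‖Complex.exp (2 * Real.pi * Complex.I * t)‖ = 1 := by
      simp [Complex.norm_exp]
    rw [norm_mul, h1, one_mul]
    refine h.trans ?_
    simp only [prodWeight, oscMap_apply, mul_assoc C]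
    refine mul_le_mul_of_nonneg_left ?_ hC.le
    have e (x y a b c d : ℝ) : (1 + x ^ 2)⁻¹ * (1 + y ^ 2)⁻¹ * (1 + c ^ 2)⁻¹ * (1 + d ^ 2)⁻¹ *
        (1 + a ^ 2)⁻¹ * (1 + b ^ 2)⁻¹ ≤
          (1 + a ^ 2)⁻¹ * (1 + b ^ 2)⁻¹ * ((1 + c ^ 2)⁻¹ * (1 + d ^ 2)⁻¹) := by
      refine le_trans (le_of_eq ?_) (mul_le_of_le_one_left (by positivity)
        (mul_le_one₀ (inv_one_add_sq_le_one x) (by positivity) (inv_one_add_sq_le_one y)))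
      ring
    exact e _ _ _ _ _ _

theorem exists_norm_Hosc_mul_pow_le (Ψ : 𝓢(ℝ × ℝ × ℝ × ℝ × ℝ × ℝ, ℂ)) (j k : ℕ) :
    ∃ C : ℝ, 0 < C ∧ ∀ M T a₁ a₂ a₃ a₄ b₁ b₂ b₃ b₄ : ℝ, 0 < T →
      Pmax a₁ a₂ a₃ a₄ b₁ b₂ b₃ b₄ ≠ 0 →
      ‖Hosc Ψ M T a₁ a₂ a₃ a₄ b₁ b₂ b₃ b₄‖ *
          ((|Δ₂ a₁ a₂ a₃ a₄ b₁ b₂ b₃ b₄| /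
              (|Δ₀ a₁ a₂ a₃ a₄ b₁ b₂ b₃ b₄| + Pmax a₁ a₂ a₃ a₄ b₁ b₂ b₃ b₄ / T)) ^ j *
            (|Δ₁ a₁ a₂ a₃ a₄ b₁ b₂ b₃ b₄| /
              (|Δ₀ a₁ a₂ a₃ a₄ b₁ b₂ b₃ b₄| + Pmax a₁ a₂ a₃ a₄ b₁ b₂ b₃ b₄ / T)) ^ k) ≤
        C * (T ^ 2 * (|Δ₀ a₁ a₂ a₃ a₄ b₁ b₂ b₃ b₄| +
          Pmax a₁ a₂ a₃ a₄ b₁ b₂ b₃ b₄ / T))⁻¹ := by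
  obtain ⟨C, hC, h⟩ := exists_norm_integral_mul_pow_le Ψ j k
  refine ⟨C, hC, fun M T a₁ a₂ a₃ a₄ b₁ b₂ b₃ b₄ hT hP ↦ ?_⟩
  have hP0 : 0 < Pmax a₁ a₂ a₃ a₄ b₁ b₂ b₃ b₄ :=
    lt_of_le_of_ne ((abs_nonneg _).trans ((le_max_left _ _).trans (le_max_left _ _))) hP.symm
  have hmax : maxCoeff (T * (b₁ * b₂)) (T * (a₃ * a₄)) (T * (a₁ * a₂)) (T * (b₃ * b₄)) =
      T * Pmax a₁ a₂ a₃ a₄ b₁ b₂ b₃ b₄ := by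
    simp only [maxCoeff, Pmax, abs_mul T, abs_of_pos hT, mul_max_of_nonneg _ _ hT.le]
  have hdet : |T * (b₁ * b₂) * (T * (b₃ * b₄)) - T * (a₃ * a₄) * (T * (a₁ * a₂))| =
      T ^ 2 * |Δ₀ a₁ a₂ a₃ a₄ b₁ b₂ b₃ b₄| := by
    rw [← abs_of_pos (pow_pos hT 2), ← abs_mul, ← abs_neg]
    congr 1
    unfold Δ₀
    ring
  have key := h (T * (b₁ * b₂)) (T * (a₃ * a₄)) (T * (a₁ * a₂)) (T * (b₃ * b₄))
    ((b₁ + b₂) ^ 2 / (4 * M ^ 2)) (-((a₃ + a₄) ^ 2 / (4 * M ^ 2)))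
    ((a₁ + a₂) ^ 2 / (4 * M ^ 2)) (-((b₃ + b₄) ^ 2 / (4 * M ^ 2)))
    (oscPhase (T / 2 * (a₁ * b₂ + a₂ * b₁)) (T / 2 * (a₃ * b₄ + a₄ * b₃))
      ((a₁ + a₂) * (b₁ + b₂) / (4 * M ^ 2)) (-((a₃ + a₄) * (b₃ + b₄) / (4 * M ^ 2))))
    (by rw [hmax]; positivity)
  rw [← Hosc_eq_integral, hdet, hmax] at key
  simp only [oscPhase_apply, Prod.fst_zero, Prod.snd_zero, mul_zero, add_zero] at key
  have e₂ : 2 * Real.pi * (T / 2 * (a₁ * b₂ + a₂ * b₁) * (T * (a₃ * a₄)) +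
      T / 2 * (a₃ * b₄ + a₄ * b₃) * -(T * (b₁ * b₂))) =
      Real.pi * T ^ 2 * Δ₂ a₁ a₂ a₃ a₄ b₁ b₂ b₃ b₄ := by unfold Δ₂; ring
  have e₁ : 2 * Real.pi * (T / 2 * (a₁ * b₂ + a₂ * b₁) * (T * (b₃ * b₄)) +
      T / 2 * (a₃ * b₄ + a₄ * b₃) * -(T * (a₁ * a₂))) =
      -(Real.pi * T ^ 2 * Δ₁ a₁ a₂ a₃ a₄ b₁ b₂ b₃ b₄) := by unfold Δ₁; ring
  rw [e₁, e₂, abs_neg] at key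
  set R := |Δ₀ a₁ a₂ a₃ a₄ b₁ b₂ b₃ b₄| + Pmax a₁ a₂ a₃ a₄ b₁ b₂ b₃ b₄ / T with hR
  have hR0 : 0 < R := by positivity
  have hS : T ^ 2 * |Δ₀ a₁ a₂ a₃ a₄ b₁ b₂ b₃ b₄| + T * Pmax a₁ a₂ a₃ a₄ b₁ b₂ b₃ b₄ =
      T ^ 2 * R := by
    rw [hR]
    field_simp
  rw [hS] at key
  have hscale (D : ℝ) : |D| / R * (T ^ 2 * R) ≤ |Real.pi * T ^ 2 * D| := by
    rw [abs_mul, abs_of_pos (by positivity : 0 < Real.pi * T ^ 2)]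
    have h1 : |D| / R * (T ^ 2 * R) = 1 * (T ^ 2 * |D|) := by field_simp
    rw [h1, mul_assoc]
    have : 1 ≤ Real.pi := by linarith [Real.two_le_pi]
    gcongr
  refine le_of_mul_le_mul_right (a := (T ^ 2 * R) ^ (j + k)) ?_ (by positivity)
  calc _ = ‖Hosc Ψ M T a₁ a₂ a₃ a₄ b₁ b₂ b₃ b₄‖ *
        ((|Δ₂ a₁ a₂ a₃ a₄ b₁ b₂ b₃ b₄| / R * (T ^ 2 * R)) ^ j *
          (|Δ₁ a₁ a₂ a₃ a₄ b₁ b₂ b₃ b₄| / R * (T ^ 2 * R)) ^ k) := by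
        rw [mul_pow (_ / R), mul_pow (_ / R), pow_add]
        ring
    _ ≤ _ := by
        gcongr
        · exact hscale _
        · exact hscale _
    _ ≤ _ := key
    _ = _ := by ring

theorem one_add_pow_le_two_pow_mul {x : ℝ} (hx : 0 ≤ x) (n : ℕ) :
    (1 + x) ^ n ≤ 2 ^ n * (1 + x ^ n) := by
  calc (1 + x) ^ n ≤ 2 ^ (n - 1) * (1 ^ n + x ^ n) := add_pow_le zero_le_one hx n
    _ ≤ _ := by
        rw [one_pow]
        gcongr
        · norm_num
        · omega

/-- **Bound (2.11).** For every `A ≥ 0` and all `(a,b) ∈ ℝ⁸` with `|aᵢ|, |bᵢ| ≤ CM` and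
`P ≠ 0`: `|ℋ(a,b)| ≪_{A,Ψ,C} (T²(|Δ|+P/T))⁻¹ ((1+|Δ₁|/(|Δ|+P/T))(1+|Δ₂|/(|Δ|+P/T)))^{-A}`. -/
theorem Hosc_bound (Ψ : 𝓢(ℝ × ℝ × ℝ × ℝ × ℝ × ℝ, ℂ)) (Cb A : ℝ) (hCb : 1 ≤ Cb)
    (hA : 0 ≤ A) :
    ∃ C : ℝ, 0 < C ∧ ∀ M T a₁ a₂ a₃ a₄ b₁ b₂ b₃ b₄ : ℝ, 1 ≤ M → 1 ≤ T →
      (|a₁| ≤ Cb * M ∧ |a₂| ≤ Cb * M ∧ |a₃| ≤ Cb * M ∧ |a₄| ≤ Cb * M) →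
      (|b₁| ≤ Cb * M ∧ |b₂| ≤ Cb * M ∧ |b₃| ≤ Cb * M ∧ |b₄| ≤ Cb * M) →
      Pmax a₁ a₂ a₃ a₄ b₁ b₂ b₃ b₄ ≠ 0 →
      ‖Hosc Ψ M T a₁ a₂ a₃ a₄ b₁ b₂ b₃ b₄‖ ≤
        C * (T ^ 2 * (|Δ₀ a₁ a₂ a₃ a₄ b₁ b₂ b₃ b₄| +
                Pmax a₁ a₂ a₃ a₄ b₁ b₂ b₃ b₄ / T))⁻¹ *
          ((1 + |Δ₁ a₁ a₂ a₃ a₄ b₁ b₂ b₃ b₄| /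
                (|Δ₀ a₁ a₂ a₃ a₄ b₁ b₂ b₃ b₄| + Pmax a₁ a₂ a₃ a₄ b₁ b₂ b₃ b₄ / T)) *
           (1 + |Δ₂ a₁ a₂ a₃ a₄ b₁ b₂ b₃ b₄| /
                (|Δ₀ a₁ a₂ a₃ a₄ b₁ b₂ b₃ b₄| + Pmax a₁ a₂ a₃ a₄ b₁ b₂ b₃ b₄ / T))) ^ (-A) := by
  set n := ⌈A⌉₊
  obtain ⟨C₁, hC₁, h₁⟩ := exists_norm_Hosc_mul_pow_le Ψ 0 0
  obtain ⟨C₂, hC₂, h₂⟩ := exists_norm_Hosc_mul_pow_le Ψ n 0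
  obtain ⟨C₃, hC₃, h₃⟩ := exists_norm_Hosc_mul_pow_le Ψ 0 n
  obtain ⟨C₄, hC₄, h₄⟩ := exists_norm_Hosc_mul_pow_le Ψ n n
  refine ⟨2 ^ n * 2 ^ n * (C₁ + C₂ + C₃ + C₄), by positivity, ?_⟩
  intro M T a₁ a₂ a₃ a₄ b₁ b₂ b₃ b₄ _ hT _ _ hP
  have hT0 : 0 < T := by linarith
  have hP0 : 0 ≤ Pmax a₁ a₂ a₃ a₄ b₁ b₂ b₃ b₄ :=
    (abs_nonneg _).trans ((le_max_left _ _).trans (le_max_left _ _))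
  replace h₁ := h₁ M T a₁ a₂ a₃ a₄ b₁ b₂ b₃ b₄ hT0 hP
  replace h₂ := h₂ M T a₁ a₂ a₃ a₄ b₁ b₂ b₃ b₄ hT0 hP
  replace h₃ := h₃ M T a₁ a₂ a₃ a₄ b₁ b₂ b₃ b₄ hT0 hP
  replace h₄ := h₄ M T a₁ a₂ a₃ a₄ b₁ b₂ b₃ b₄ hT0 hP
  set R := |Δ₀ a₁ a₂ a₃ a₄ b₁ b₂ b₃ b₄| + Pmax a₁ a₂ a₃ a₄ b₁ b₂ b₃ b₄ / T
  set H := ‖Hosc Ψ M T a₁ a₂ a₃ a₄ b₁ b₂ b₃ b₄‖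
  have hR0 : 0 ≤ R := by positivity
  set x := |Δ₁ a₁ a₂ a₃ a₄ b₁ b₂ b₃ b₄| / R
  set y := |Δ₂ a₁ a₂ a₃ a₄ b₁ b₂ b₃ b₄| / R
  have hx : 0 ≤ x := by positivity
  have hy : 0 ≤ y := by positivity
  have hH : 0 ≤ H := norm_nonneg _
  have hxy : 1 ≤ (1 + x) * (1 + y) := one_le_mul_of_one_le_of_one_le (by linarith) (by linarith)
  rw [Real.rpow_neg (by positivity), ← div_eq_mul_inv, le_div_iff₀ (by positivity)]
  simp only [pow_zero, one_mul, mul_one] at h₁ h₂ h₃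
  calc H * ((1 + x) * (1 + y)) ^ A ≤ H * ((1 + x) * (1 + y)) ^ (n : ℝ) := by
        gcongr
        exact Nat.le_ceil A
    _ = H * ((1 + x) ^ n * (1 + y) ^ n) := by rw [Real.rpow_natCast, mul_pow]
    _ ≤ H * ((2 ^ n * (1 + x ^ n)) * (2 ^ n * (1 + y ^ n))) := by
        gcongr
        · exact one_add_pow_le_two_pow_mul hx n
        · exact one_add_pow_le_two_pow_mul hy n
    _ = 2 ^ n * 2 ^ n * (H + H * y ^ n + H * x ^ n + H * (y ^ n * x ^ n)) := by ring
    _ ≤ 2 ^ n * 2 ^ n * (C₁ * (T ^ 2 * R)⁻¹ + C₂ * (T ^ 2 * R)⁻¹ + C₃ * (T ^ 2 * R)⁻¹ +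
          C₄ * (T ^ 2 * R)⁻¹) := by gcongr
    _ = _ := by ring
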